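/- For $a\in(0,1/2]$ and $r\in(0,1)$ let $r'=\sqrt{1-r^2}$, $\mathcal K_a(r)=\frac{\pi}{2}\,F(a,1-a;1;r^2)$ with $F$ the Gaussian hypergeometric function, $\mathcal K'_a(r)=\mathcal K_a(r')$, and $\mu_a(r)=\frac{\pi}{2\sin(\pi a)}\cdot\frac{\mathcal K'_a(r)}{\mathcal K_a(r)}$, a strictly decreasing homeomorphism from $(0,1)$ onto $(0,\infty)$. For $K>0$ put $\varphi_K^a(r)=\mu_a^{-1}(\mu_a(r)/K)$, and for $K,x>0$ put $\eta_K^a(x)=(s/s')^2$, where $s=\varphi_K^a\big(\sqrt{x/(1+x)}\big)$ and $s'=\sqrt{1-s^2}$. Let $a\in(0,1/2]$, $x\in(0,\infty)$ and $r=\sqrt{x/(x+1)}$. Then: (1) the function $f(K)=\dfrac{\log\eta_K^a(x)-\log x}{K-1}$ is strictly decreasing from $(1,\infty)$ onto $\left(\dfrac{\pi\,\mathcal K_a(r)}{\sin(\pi a)\,\mathcal K'_a(r)},\ \dfrac{4\,\mathcal K_a(r)\,\mathcal K'_a(r)}{\pi\sin(\pi a)}\right)$; (2) the function $g(K)=\dfrac{\eta_K^a(x)-x}{K-1}$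 is strictly increasing from $(1,\infty)$ onto $\left(\dfrac{4\,r^2\,\mathcal K_a(r)\,\mathcal K'_a(r)}{\pi\,r'^2\sin(\pi a)},\ \infty\right)$. -/

import Mathlib

/-- The generalized complete elliptic integral of the first kind
`𝒦ₐ(r) = (π/2) · F(a, 1 - a; 1; r²)`, for `r ∈ (0,1)`. -/
noncomputable def ellK (a r : ℝ) : ℝ :=
  Real.pi / 2 * ordinaryHypergeometric a (1 - a) (1 : ℝ) (r ^ 2)

/-- The decreasing homeomorphism `μₐ : (0,1) → (0,∞)`. -/
noncomputable def muFn (a r : ℝ) : ℝ :=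
  Real.pi / (2 * Real.sin (Real.pi * a)) * (ellK a (Real.sqrt (1 - r ^ 2)) / ellK a r)

/-- The inverse of `μₐ : (0,1) → (0,∞)`; only its values on `(0,∞)` are meaningful. -/
noncomputable def muInv (a : ℝ) : ℝ → ℝ := Function.invFunOn (muFn a) (Set.Ioo 0 1)

/-- The modular function `φ_K^a(r) = μₐ⁻¹(μₐ(r) / K)`. -/
noncomputable def phiK (a K r : ℝ) : ℝ := muInv a (muFn a r / K)

/-- `η_K^a(x) = (s / s')²` with `s = φ_K^a(√(x / (1 + x)))` and `s' = √(1 - s²)`. -/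
noncomputable def etaK (a K x : ℝ) : ℝ :=
  (phiK a K (Real.sqrt (x / (1 + x))) /
    Real.sqrt (1 - phiK a K (Real.sqrt (x / (1 + x))) ^ 2)) ^ 2

section Hypergeometric

open Set Filter Topology Finset

/-! ### Power series with bounded coefficients -/

theorem summable_bounded_mul_pow {c : ℕ → ℝ} {M : ℝ} (hc : ∀ n, |c n| ≤ M) {x : ℝ}
    (hx : |x| < 1) : Summable fun n => c n * x ^ n := by
  refine Summable.of_norm_bounded (g := fun n => M * |x| ^ n)
    ((summable_geometric_of_lt_one (abs_nonneg x) hx).mul_left M) fun n => ?_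
  rw [Real.norm_eq_abs, abs_mul, abs_pow]
  exact mul_le_mul_of_nonneg_right (hc n) (by positivity)

theorem summable_mul_pow_pred {ρ : ℝ} (h0 : 0 < ρ) (h1 : ρ < 1) :
    Summable fun n : ℕ => (n : ℝ) * ρ ^ (n - 1) := by
  have h := (summable_pow_mul_geometric_of_norm_lt_one 1
    (r := ρ) (by rwa [Real.norm_eq_abs, abs_of_pos h0])).mul_left ρ⁻¹
  refine h.congr fun n => ?_
  rcases n with _ | n
  · simp
  · simp only [Nat.add_sub_cancel, pow_succ]
    field_simp

theorem hasDerivAt_tsum_mul_pow {c : ℕ → ℝ} {M : ℝ} (hc : ∀ n, |c n| ≤ M) {x : ℝ}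
    (hx : |x| < 1) :
    HasDerivAt (fun z => ∑' n, c n * z ^ n) (∑' n : ℕ, ((n + 1) * c (n + 1)) * x ^ n) x := by
  obtain ⟨ρ, hxρ, hρ⟩ := exists_between hx
  have h0 : 0 < ρ := (abs_nonneg x).trans_lt hxρ
  have hM : 0 ≤ M := (abs_nonneg _).trans (hc 0)
  have hu := (summable_mul_pow_pred h0 hρ).mul_left M
  have hbound : ∀ (n : ℕ) (y : ℝ), y ∈ Metric.ball (0 : ℝ) ρ →
      ‖c n * ((n : ℝ) * y ^ (n - 1))‖ ≤ M * ((n : ℝ) * ρ ^ (n - 1)) := by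
    intro n y hy
    rw [mem_ball_zero_iff, Real.norm_eq_abs] at hy
    rw [Real.norm_eq_abs, abs_mul, abs_mul, abs_pow, Nat.abs_cast]
    have := hc n
    gcongr
  have hxm : x ∈ Metric.ball (0 : ℝ) ρ := by simpa using hxρ
  have h := hasDerivAt_tsum_of_isPreconnected (g := fun n z => c n * z ^ n)
    (g' := fun n z => c n * ((n : ℝ) * z ^ (n - 1))) hu Metric.isOpen_ball
    (convex_ball (0 : ℝ) ρ).isPreconnected
    (fun n y _ => (hasDerivAt_pow n y).const_mul (c n)) hbound
    (Metric.mem_ball_self h0) (summable_bounded_mul_pow hc (by simp)) hxm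
  refine h.congr_deriv ?_
  have hs : Summable fun n : ℕ => c n * ((n : ℝ) * x ^ (n - 1)) :=
    Summable.of_norm_bounded hu fun n => hbound n x hxm
  rw [hs.tsum_eq_zero_add]
  simp only [Nat.cast_zero, zero_mul, mul_zero, zero_add, Nat.add_sub_cancel, Nat.cast_add,
    Nat.cast_one]
  exact tsum_congr fun n => by ring

/-! ### The function `F(a, 1 - a; 1; x)` -/

/-- The Taylor coefficients `(a)ₙ (1 - a)ₙ / (n!)²` of `F(a, 1 - a; 1; x)`. -/
noncomputable def hypCoeff (a : ℝ) (n : ℕ) : ℝ :=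
  ∏ k ∈ range n, (a + k) * (1 - a + k) / ((k : ℝ) + 1) ^ 2

/-- `F(a, 1 - a; 1; x)` as a power series. -/
noncomputable def hypF (a x : ℝ) : ℝ := ∑' n, hypCoeff a n * x ^ n

/-- The power series of `a (1 - a) F(a, 1 - a; 2; x)`, which equals `(1 - x) F'(x)` for
`F(x) = F(a, 1 - a; 1; x)`. -/
noncomputable def hypP (a x : ℝ) : ℝ :=
  ∑' n : ℕ, (a * (1 - a) * hypCoeff a n / (n + 1)) * x ^ n

theorem hypCoeff_zero (a : ℝ) : hypCoeff a 0 = 1 := by simp [hypCoeff]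

theorem hypCoeff_succ (a : ℝ) (n : ℕ) :
    hypCoeff a (n + 1) = hypCoeff a n * ((a + n) * (1 - a + n) / ((n : ℝ) + 1) ^ 2) := by
  rw [hypCoeff, prod_range_succ, hypCoeff]

theorem hypCoeff_eq (a : ℝ) (n : ℕ) :
    hypCoeff a n = ((n.factorial : ℝ)⁻¹ * (ascPochhammer ℝ n).eval a *
      (ascPochhammer ℝ n).eval (1 - a) * ((ascPochhammer ℝ n).eval 1)⁻¹) := by
  induction n with
  | zero => simp [hypCoeff_zero]
  | succ n ih =>
    rw [hypCoeff_succ, ih]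
    simp only [ascPochhammer_succ_eval, Nat.factorial_succ, Nat.cast_mul, Nat.cast_add,
      Nat.cast_one, ascPochhammer_eval_one]
    have : (n.factorial : ℝ) ≠ 0 := by positivity
    field_simp
    ring

theorem ordinaryHypergeometric_eq_hypF (a x : ℝ) :
    ordinaryHypergeometric a (1 - a) (1 : ℝ) x = hypF a x := by
  rw [ordinaryHypergeometric_eq_tsum, hypF]
  exact tsum_congr fun n => by rw [hypCoeff_eq, smul_eq_mul]

theorem hypCoeff_pos {a : ℝ} (h0 : 0 < a) (h1 : a < 1) (n : ℕ) : 0 < hypCoeff a n := by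
  refine prod_pos fun k _ => ?_
  have : 0 < 1 - a := by linarith
  positivity

theorem mul_hypCoeff_succ_sub (a : ℝ) (n : ℕ) :
    ((n : ℝ) + 1) * hypCoeff a (n + 1) - n * hypCoeff a n =
      a * (1 - a) * hypCoeff a n / (n + 1) := by
  rw [hypCoeff_succ]
  field_simp
  ring

theorem mul_one_sub_le_quarter (a : ℝ) : a * (1 - a) ≤ 1 / 4 := by nlinarith [sq_nonneg (a - 1 / 2)]

theorem hypCoeff_le_one {a : ℝ} (h0 : 0 < a) (h1 : a < 1) (n : ℕ) : hypCoeff a n ≤ 1 := by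
  refine prod_le_one (fun k _ => ?_) fun k _ => ?_
  · have : 0 < 1 - a := by linarith
    positivity
  · rw [div_le_one (by positivity)]
    have : (0 : ℝ) ≤ k := k.cast_nonneg
    nlinarith [mul_one_sub_le_quarter a]

theorem abs_hypCoeff_le {a : ℝ} (h0 : 0 < a) (h1 : a < 1) (n : ℕ) : |hypCoeff a n| ≤ 1 := by
  rw [abs_of_pos (hypCoeff_pos h0 h1 n)]
  exact hypCoeff_le_one h0 h1 n

theorem hypP_coeff_nonneg {a : ℝ} (h0 : 0 < a) (h1 : a < 1) (n : ℕ) :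
    0 ≤ a * (1 - a) * hypCoeff a n / (n + 1) := by
  have := hypCoeff_pos h0 h1 n
  have : 0 < 1 - a := by linarith
  positivity

theorem hypP_coeff_le {a : ℝ} (h0 : 0 < a) (h1 : a < 1) (n : ℕ) :
    a * (1 - a) * hypCoeff a n / (n + 1) ≤ 1 / 4 * hypCoeff a n := by
  rw [div_le_iff₀ (by positivity)]
  have h := mul_le_mul_of_nonneg_right (mul_one_sub_le_quarter a) (hypCoeff_pos h0 h1 n).le
  have : (0 : ℝ) ≤ n := n.cast_nonneg
  nlinarith [mul_nonneg (hypCoeff_pos h0 h1 n).le this]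

theorem abs_hypP_coeff_le {a : ℝ} (h0 : 0 < a) (h1 : a < 1) (n : ℕ) :
    |a * (1 - a) * hypCoeff a n / (n + 1)| ≤ 1 := by
  rw [abs_of_nonneg (hypP_coeff_nonneg h0 h1 n)]
  linarith [hypP_coeff_le h0 h1 n, hypCoeff_le_one h0 h1 n]

theorem summable_hypF {a : ℝ} (h0 : 0 < a) (h1 : a < 1) {x : ℝ} (hx : |x| < 1) :
    Summable fun n => hypCoeff a n * x ^ n :=
  summable_bounded_mul_pow (abs_hypCoeff_le h0 h1) hx

theorem summable_hypP {a : ℝ} (h0 : 0 < a) (h1 : a < 1) {x : ℝ} (hx : |x| < 1) :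
    Summable fun n : ℕ => (a * (1 - a) * hypCoeff a n / (n + 1)) * x ^ n :=
  summable_bounded_mul_pow (abs_hypP_coeff_le h0 h1) hx

theorem natCast_mul_hypCoeff_le {a : ℝ} (h0 : 0 < a) (h1 : a < 1) (n : ℕ) :
    (n : ℝ) * hypCoeff a n ≤ n := by
  have : (0 : ℝ) ≤ n := n.cast_nonneg
  nlinarith [hypCoeff_le_one h0 h1 n]

theorem summable_natCast_mul_hypCoeff {a : ℝ} (h0 : 0 < a) (h1 : a < 1) {x : ℝ}
    (hx : |x| < 1) : Summable fun n : ℕ => ((n : ℝ) * hypCoeff a n) * x ^ n := by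
  refine Summable.of_norm_bounded (g := fun n : ℕ => (n : ℝ) ^ 1 * |x| ^ n)
    (summable_pow_mul_geometric_of_norm_lt_one 1 (by simpa using hx)) fun n => ?_
  rw [Real.norm_eq_abs, abs_mul, abs_pow, pow_one,
    abs_of_nonneg (mul_nonneg n.cast_nonneg (hypCoeff_pos h0 h1 n).le)]
  exact mul_le_mul_of_nonneg_right (natCast_mul_hypCoeff_le h0 h1 n) (by positivity)

theorem hasDerivAt_hypF {a : ℝ} (h0 : 0 < a) (h1 : a < 1) {x : ℝ} (hx : |x| < 1) :
    HasDerivAt (hypF a) (hypP a x / (1 - x)) x := by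
  have h := hasDerivAt_tsum_mul_pow (abs_hypCoeff_le h0 h1) hx
  refine h.congr_deriv ?_
  have hx1 : 1 - x ≠ 0 := by linarith [(abs_lt.1 hx).2]
  rw [eq_div_iff hx1]
  have hs := summable_natCast_mul_hypCoeff h0 h1 hx
  have hP := summable_hypP h0 h1 hx
  have hshift : ∑' n : ℕ, ((n : ℝ) * hypCoeff a n) * x ^ n =
      x * ∑' n : ℕ, (((n : ℝ) + 1) * hypCoeff a (n + 1)) * x ^ n := by
    rw [hs.tsum_eq_zero_add, ← tsum_mul_left]
    simp only [Nat.cast_zero, zero_mul, zero_add, Nat.cast_add, Nat.cast_one]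
    exact tsum_congr fun n => by ring
  have hsum : ∑' n : ℕ, (((n : ℝ) + 1) * hypCoeff a (n + 1)) * x ^ n =
      hypP a x + ∑' n : ℕ, ((n : ℝ) * hypCoeff a n) * x ^ n := by
    rw [hypP, ← hP.tsum_add hs]
    exact tsum_congr fun n => by rw [← mul_hypCoeff_succ_sub]; ring
  rw [hshift] at hsum
  linear_combination hsum

theorem hasDerivAt_mul_hypP {a : ℝ} (h0 : 0 < a) (h1 : a < 1) {x : ℝ} (hx : |x| < 1) :
    HasDerivAt (fun z => z * hypP a z) (a * (1 - a) * hypF a x) x := by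
  let q : ℕ → ℝ := fun n => if n = 0 then 0 else a * (1 - a) * hypCoeff a (n - 1) / n
  have hq : ∀ n, |q n| ≤ 1 := by
    rintro (_ | n)
    · simp [q]
    · simpa [q] using abs_hypP_coeff_le h0 h1 n
  have h := hasDerivAt_tsum_mul_pow hq hx
  have hval : ∑' n : ℕ, (((n : ℝ) + 1) * q (n + 1)) * x ^ n = a * (1 - a) * hypF a x := by
    rw [hypF, ← tsum_mul_left]
    refine tsum_congr fun n => ?_
    simp only [q, Nat.add_eq_zero_iff, one_ne_zero, and_false, if_false, Nat.add_sub_cancel]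
    push_cast
    field_simp
  rw [hval] at h
  refine h.congr_of_eventuallyEq ?_
  have hnhds : ∀ᶠ z : ℝ in 𝓝 x, |z| < 1 := continuous_abs.continuousAt.eventually_lt_const hx
  filter_upwards [hnhds] with z hz
  rw [(summable_bounded_mul_pow hq hz).tsum_eq_zero_add, hypP, ← tsum_mul_left]
  simp only [q, if_true, zero_mul, zero_add, Nat.add_eq_zero_iff, one_ne_zero, and_false,
    if_false, Nat.add_sub_cancel]
  exact tsum_congr fun n => by push_cast; ring

theorem abs_lt_one_of_mem_Ico {x : ℝ} (hx : x ∈ Ico (0 : ℝ) 1) : |x| < 1 := by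
  rw [abs_of_nonneg hx.1]; exact hx.2

theorem one_le_hypF {a : ℝ} (h0 : 0 < a) (h1 : a < 1) {x : ℝ} (hx : x ∈ Ico (0 : ℝ) 1) :
    1 ≤ hypF a x := by
  have h := (summable_hypF h0 h1 (abs_lt_one_of_mem_Ico hx)).le_tsum 0 fun n _ =>
    mul_nonneg (hypCoeff_pos h0 h1 n).le (pow_nonneg hx.1 n)
  simpa [hypCoeff_zero, hypF] using h

theorem hypF_pos {a : ℝ} (h0 : 0 < a) (h1 : a < 1) {x : ℝ} (hx : x ∈ Ico (0 : ℝ) 1) :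
    0 < hypF a x := one_pos.trans_le (one_le_hypF h0 h1 hx)

theorem hypF_zero (a : ℝ) : hypF a 0 = 1 := by
  rw [← ordinaryHypergeometric_eq_hypF, ordinaryHypergeometric_zero]

theorem le_hypP {a : ℝ} (h0 : 0 < a) (h1 : a < 1) {x : ℝ} (hx : x ∈ Ico (0 : ℝ) 1) :
    a * (1 - a) ≤ hypP a x := by
  have h := (summable_hypP h0 h1 (abs_lt_one_of_mem_Ico hx)).le_tsum 0 fun n _ =>
    mul_nonneg (hypP_coeff_nonneg h0 h1 n) (pow_nonneg hx.1 n)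
  simpa [hypCoeff_zero, hypP] using h

theorem hypP_pos {a : ℝ} (h0 : 0 < a) (h1 : a < 1) {x : ℝ} (hx : x ∈ Ico (0 : ℝ) 1) :
    0 < hypP a x := (mul_pos h0 (by linarith)).trans_le (le_hypP h0 h1 hx)

theorem hypP_le {a : ℝ} (h0 : 0 < a) (h1 : a < 1) {x : ℝ} (hx : x ∈ Ico (0 : ℝ) 1) :
    hypP a x ≤ 1 / 4 * hypF a x := by
  have hx' := abs_lt_one_of_mem_Ico hx
  rw [hypP, hypF, ← tsum_mul_left]
  refine (summable_hypP h0 h1 hx').tsum_le_tsum (fun n => ?_)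
    ((summable_hypF h0 h1 hx').mul_left _)
  rw [← mul_assoc]
  exact mul_le_mul_of_nonneg_right (hypP_coeff_le h0 h1 n) (pow_nonneg hx.1 n)

theorem continuousOn_hypF {a : ℝ} (h0 : 0 < a) (h1 : a < 1) :
    ContinuousOn (hypF a) (Ico 0 1) := fun _ hx =>
  (hasDerivAt_hypF h0 h1 (abs_lt_one_of_mem_Ico hx)).continuousAt.continuousWithinAt

theorem strictMonoOn_hypF {a : ℝ} (h0 : 0 < a) (h1 : a < 1) :
    StrictMonoOn (hypF a) (Ico 0 1) := by
  refine strictMonoOn_of_deriv_pos (convex_Ico 0 1) (continuousOn_hypF h0 h1) fun x hx => ?_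
  have hx := interior_subset hx
  rw [(hasDerivAt_hypF h0 h1 (abs_lt_one_of_mem_Ico hx)).deriv]
  exact div_pos (hypP_pos h0 h1 hx) (by linarith [hx.2])

theorem antitoneOn_one_sub_mul_hypF_sq {a : ℝ} (h0 : 0 < a) (h1 : a < 1) :
    AntitoneOn (fun x => (1 - x) * hypF a x ^ 2) (Ico 0 1) := by
  have hd : ∀ x ∈ Ico (0 : ℝ) 1, HasDerivAt (fun x => (1 - x) * hypF a x ^ 2)
      (-1 * hypF a x ^ 2 + (1 - x) * (2 * hypF a x ^ 1 * (hypP a x / (1 - x)))) x :=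
    fun x hx => ((hasDerivAt_id x).const_sub 1).mul
      ((hasDerivAt_hypF h0 h1 (abs_lt_one_of_mem_Ico hx)).pow 2)
  refine antitoneOn_of_deriv_nonpos (convex_Ico 0 1)
    (fun x hx => (hd x hx).continuousAt.continuousWithinAt)
    (fun x hx => (hd x (interior_subset hx)).differentiableAt.differentiableWithinAt)
    fun x hx => ?_
  have hx := interior_subset hx
  rw [(hd x hx).deriv]
  have hx1 : 1 - x ≠ 0 := by linarith [hx.2]
  have e : -1 * hypF a x ^ 2 + (1 - x) * (2 * hypF a x ^ 1 * (hypP a x / (1 - x))) =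
      hypF a x * (2 * hypP a x - hypF a x) := by
    field_simp
    ring
  rw [e]
  have := hypF_pos h0 h1 hx
  exact mul_nonpos_of_nonneg_of_nonpos this.le (by linarith [hypP_le h0 h1 hx])

theorem hypF_le_inv_sqrt {a : ℝ} (h0 : 0 < a) (h1 : a < 1) {x : ℝ} (hx : x ∈ Ico (0 : ℝ) 1) :
    hypF a x ≤ (√(1 - x))⁻¹ := by
  have h := antitoneOn_one_sub_mul_hypF_sq h0 h1 (left_mem_Ico.2 one_pos) hx hx.1
  simp only [sub_zero, hypF_zero, one_pow, mul_one] at h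
  have hx1 : 0 < 1 - x := by linarith [hx.2]
  rw [le_inv_comm₀ (hypF_pos h0 h1 hx) (Real.sqrt_pos.2 hx1), ← Real.sqrt_sq
    (inv_pos.2 (hypF_pos h0 h1 hx)).le]
  refine Real.sqrt_le_sqrt ?_
  rw [inv_pow, ← one_div, le_div_iff₀ (pow_pos (hypF_pos h0 h1 hx) 2)]
  exact h

theorem hypF_ge_log {a : ℝ} (h0 : 0 < a) (h1 : a < 1) {x : ℝ} (hx : x ∈ Ico (0 : ℝ) 1) :
    1 - a * (1 - a) * Real.log (1 - x) ≤ hypF a x := by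
  have hd : ∀ x ∈ Ico (0 : ℝ) 1,
      HasDerivAt (fun x => hypF a x + a * (1 - a) * Real.log (1 - x))
      (hypP a x / (1 - x) + a * (1 - a) * (-1 / (1 - x))) x :=
    fun x hx => (hasDerivAt_hypF h0 h1 (abs_lt_one_of_mem_Ico hx)).add
      ((((hasDerivAt_id x).const_sub 1).log (by simp only [id]; linarith [hx.2])).const_mul _)
  have hmono : MonotoneOn (fun x => hypF a x + a * (1 - a) * Real.log (1 - x)) (Ico 0 1) := by
    refine monotoneOn_of_deriv_nonneg (convex_Ico 0 1)
      (fun x hx => (hd x hx).continuousAt.continuousWithinAt)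
      (fun x hx => (hd x (interior_subset hx)).differentiableAt.differentiableWithinAt)
      fun x hx => ?_
    have hx := interior_subset hx
    rw [(hd x hx).deriv]
    have hx1 : 0 < 1 - x := by linarith [hx.2]
    have e : hypP a x / (1 - x) + a * (1 - a) * (-1 / (1 - x)) =
      (hypP a x - a * (1 - a)) / (1 - x) := by ring
    rw [e]
    exact div_nonneg (by linarith [le_hypP h0 h1 hx]) hx1.le
  have h := hmono (left_mem_Ico.2 one_pos) hx hx.1
  simp only [sub_zero, Real.log_one, mul_zero, add_zero, hypF_zero] at h
  linarith

theorem tendsto_hypF_atTop {a : ℝ} (h0 : 0 < a) (h1 : a < 1) :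
    Tendsto (hypF a) (𝓝[<] 1) atTop := by
  have hl : Tendsto (fun x : ℝ => 1 - x) (𝓝[<] 1) (𝓝[>] 0) := by
    refine tendsto_nhdsWithin_iff.2 ⟨?_, ?_⟩
    · have : Tendsto (fun x : ℝ => 1 - x) (𝓝 1) (𝓝 (1 - 1)) :=
        (continuous_const.sub continuous_id).tendsto 1
      rw [sub_self] at this
      exact this.mono_left nhdsWithin_le_nhds
    · filter_upwards [self_mem_nhdsWithin] with x hx
      simpa using hx
  have hlog := (Real.tendsto_log_nhdsGT_zero.comp hl).const_mul_atBot
    (r := a * (1 - a)) (mul_pos h0 (by linarith))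
  have h2 : Tendsto (fun x => 1 + -(a * (1 - a) * Real.log (1 - x))) (𝓝[<] 1) atTop :=
    tendsto_atTop_add_const_left _ 1 (tendsto_neg_atBot_atTop.comp hlog)
  refine tendsto_atTop_mono' _ ?_ h2
  filter_upwards [Ico_mem_nhdsLT (zero_lt_one' ℝ)] with x hx
  linarith [hypF_ge_log h0 h1 hx]

/-! ### The Wronskian -/

theorem sum_hypP_coeff (a : ℝ) (n : ℕ) :
    ∑ k ∈ range n, a * (1 - a) * hypCoeff a k / (k + 1) = n * hypCoeff a n := by
  induction n with
  | zero => simp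
  | succ n ih =>
    rw [sum_range_succ, ih, ← mul_hypCoeff_succ_sub]
    push_cast
    ring

theorem hypCoeff_eq_prod_div (a : ℝ) (n : ℕ) : hypCoeff a n =
    (∏ k ∈ range n, (a + k)) * (∏ k ∈ range n, (1 - a + k)) / (n.factorial : ℝ) ^ 2 := by
  induction n with
  | zero => simp [hypCoeff_zero]
  | succ n ih =>
    rw [hypCoeff_succ, ih, prod_range_succ, prod_range_succ, Nat.factorial_succ]
    have : (n.factorial : ℝ) ≠ 0 := by positivity
    push_cast
    field_simp

theorem tendsto_natCast_mul_hypCoeff {a : ℝ} (h0 : 0 < a) (h1 : a < 1) :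
    Tendsto (fun n : ℕ => (n : ℝ) * hypCoeff a n) atTop
      (𝓝 (Real.sin (Real.pi * a) / Real.pi)) := by
  have hG := ((Real.GammaSeq_tendsto_Gamma a).mul (Real.GammaSeq_tendsto_Gamma (1 - a))).inv₀
    (mul_pos (Real.Gamma_pos_of_pos h0) (Real.Gamma_pos_of_pos (by linarith : 0 < 1 - a))).ne'
  rw [Real.Gamma_mul_Gamma_one_sub, inv_div] at hG
  have hr : Tendsto (fun n : ℕ => ((n : ℝ) / (n + a)) * ((n : ℝ) / (n + (1 - a)))) atTop
      (𝓝 (1 * 1)) :=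
    (tendsto_natCast_div_add_atTop a).mul (tendsto_natCast_div_add_atTop (1 - a))
  have h := hG.mul hr
  rw [mul_one, mul_one] at h
  refine h.congr' ?_
  filter_upwards [eventually_gt_atTop 0] with n hn
  have hn : (0 : ℝ) < n := by exact_mod_cast hn
  have hpow : (n : ℝ) ^ a * (n : ℝ) ^ (1 - a) = n := by
    rw [← Real.rpow_add hn]; simp
  have e1 : Real.GammaSeq a n * Real.GammaSeq (1 - a) n =
      n * (n.factorial : ℝ) ^ 2 / ((∏ k ∈ range n, (a + k)) * (∏ k ∈ range n, (1 - a + k)) *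
        ((a + n) * (1 - a + n))) := by
    rw [Real.GammaSeq, Real.GammaSeq, prod_range_succ, prod_range_succ, div_mul_div_comm]
    congr 1
    · linear_combination (n.factorial : ℝ) ^ 2 * hpow
    · ring
  rw [e1, hypCoeff_eq_prod_div, inv_div]
  have hA : (n.factorial : ℝ) ≠ 0 := by positivity
  have h3 : (n : ℝ) + a ≠ 0 := by positivity
  have h4 : (n : ℝ) + (1 - a) ≠ 0 := by
    have : 0 < 1 - a := by linarith
    positivity
  field_simp
  ring

theorem tendsto_hypP {a : ℝ} (h0 : 0 < a) (h1 : a < 1) :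
    Tendsto (hypP a) (𝓝[<] 1) (𝓝 (Real.sin (Real.pi * a) / Real.pi)) := by
  refine Real.tendsto_tsum_powerSeries_nhdsWithin_lt ?_
  simp_rw [sum_hypP_coeff]
  exact tendsto_natCast_mul_hypCoeff h0 h1

end Hypergeometric

section Modulus

open Set Filter Topology Finset

theorem one_sub_mem_Ioo {t : ℝ} (ht : t ∈ Ioo (0 : ℝ) 1) : 1 - t ∈ Ioo (0 : ℝ) 1 :=
  ⟨by linarith [ht.2], by linarith [ht.1]⟩

theorem tendsto_one_sub_nhdsGT_zero :
    Tendsto (fun t : ℝ => 1 - t) (𝓝[>] 0) (𝓝[<] 1) := by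
  refine tendsto_nhdsWithin_iff.2 ⟨?_, ?_⟩
  · have : Tendsto (fun x : ℝ => 1 - x) (𝓝 0) (𝓝 (1 - 0)) :=
      (continuous_const.sub continuous_id).tendsto 0
    rw [sub_zero] at this
    exact this.mono_left nhdsWithin_le_nhds
  · filter_upwards [self_mem_nhdsWithin] with x hx
    simpa using hx

theorem hasDerivAt_hypF_one_sub {a : ℝ} (h0 : 0 < a) (h1 : a < 1) {t : ℝ}
    (ht : t ∈ Ioo (0 : ℝ) 1) :
    HasDerivAt (fun t => hypF a (1 - t)) (-(hypP a (1 - t) / t)) t := by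
  have h := hasDerivAt_hypF h0 h1
    (abs_lt_one_of_mem_Ico (Ioo_subset_Ico_self (one_sub_mem_Ioo ht)))
  have h2 := h.comp t ((hasDerivAt_id t).const_sub 1)
  refine h2.congr_deriv ?_
  rw [sub_sub_cancel, mul_neg, mul_one]

theorem hasDerivAt_wronskian {a : ℝ} (h0 : 0 < a) (h1 : a < 1) {t : ℝ}
    (ht : t ∈ Ioo (0 : ℝ) 1) :
    HasDerivAt (fun t => t * hypP a t * hypF a (1 - t) + hypF a t * ((1 - t) * hypP a (1 - t)))
      0 t := by
  have ht' := one_sub_mem_Ioo ht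
  have hQ := hasDerivAt_mul_hypP h0 h1 (abs_lt_one_of_mem_Ico (Ioo_subset_Ico_self ht))
  have hF := hasDerivAt_hypF h0 h1 (abs_lt_one_of_mem_Ico (Ioo_subset_Ico_self ht))
  have hQ' := (hasDerivAt_mul_hypP h0 h1
    (abs_lt_one_of_mem_Ico (Ioo_subset_Ico_self ht'))).comp t ((hasDerivAt_id t).const_sub 1)
  have h := (hQ.mul (hasDerivAt_hypF_one_sub h0 h1 ht)).add (hF.mul hQ')
  refine h.congr_deriv ?_
  have e1 : t ≠ 0 := ht.1.ne'
  have e2 : 1 - t ≠ 0 := ht'.1.ne'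
  simp only [Function.comp]
  field_simp
  ring

/-- The generalized Legendre relation, in terms of `F` and `(1 - x) F'(x)`. -/
theorem wronskian_eq {a : ℝ} (h0 : 0 < a) (h1 : a < 1) {t : ℝ} (ht : t ∈ Ioo (0 : ℝ) 1) :
    t * hypP a t * hypF a (1 - t) + hypF a t * ((1 - t) * hypP a (1 - t)) =
      Real.sin (Real.pi * a) / Real.pi := by
  set W : ℝ → ℝ := fun t =>
    t * hypP a t * hypF a (1 - t) + hypF a t * ((1 - t) * hypP a (1 - t))
  have hconst : ∀ s ∈ Ioo (0 : ℝ) 1, W s = W t := fun s hs =>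
    isOpen_Ioo.is_const_of_deriv_eq_zero isPreconnected_Ioo
      (fun u hu => (hasDerivAt_wronskian h0 h1 hu).differentiableAt.differentiableWithinAt)
      (fun u hu => (hasDerivAt_wronskian h0 h1 hu).deriv) hs ht
  have hF0 : Tendsto (hypF a) (𝓝[>] 0) (𝓝 1) := by
    have := (hasDerivAt_hypF h0 h1 (x := 0) (by simp)).continuousAt.tendsto
    rw [hypF_zero] at this
    exact this.mono_left nhdsWithin_le_nhds
  have hid : Tendsto (fun t : ℝ => 1 - t) (𝓝[>] 0) (𝓝 1) :=
    tendsto_one_sub_nhdsGT_zero.mono_right nhdsWithin_le_nhds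
  have hsecond : Tendsto (fun t => hypF a t * ((1 - t) * hypP a (1 - t))) (𝓝[>] 0)
      (𝓝 (1 * (1 * (Real.sin (Real.pi * a) / Real.pi)))) :=
    hF0.mul (hid.mul ((tendsto_hypP h0 h1).comp tendsto_one_sub_nhdsGT_zero))
  have hsqrt : Tendsto (fun t => √t * hypF a t) (𝓝[>] 0) (𝓝 (√0 * 1)) :=
    (Real.continuous_sqrt.continuousAt.tendsto.mono_left nhdsWithin_le_nhds).mul hF0
  have hmem : Ioo (0 : ℝ) 1 ∈ 𝓝[>] (0 : ℝ) := Ioo_mem_nhdsGT one_pos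
  have hfirst : Tendsto (fun t => t * hypP a t * hypF a (1 - t)) (𝓝[>] 0) (𝓝 0) := by
    rw [Real.sqrt_zero, zero_mul] at hsqrt
    refine tendsto_of_tendsto_of_tendsto_of_le_of_le' tendsto_const_nhds hsqrt ?_ ?_
    · filter_upwards [hmem] with s hs
      have := hypP_pos h0 h1 (Ioo_subset_Ico_self hs)
      have := hypF_pos h0 h1 (Ioo_subset_Ico_self (one_sub_mem_Ioo hs))
      have := hs.1
      positivity
    · filter_upwards [hmem] with s hs
      have hs0 := hs.1
      have hsq : 0 < √s := Real.sqrt_pos.2 hs0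
      have hP := hypP_le h0 h1 (Ioo_subset_Ico_self hs)
      have hPpos := hypP_pos h0 h1 (Ioo_subset_Ico_self hs)
      have hFpos := hypF_pos h0 h1 (Ioo_subset_Ico_self hs)
      have hle := hypF_le_inv_sqrt h0 h1 (Ioo_subset_Ico_self (one_sub_mem_Ioo hs))
      rw [sub_sub_cancel] at hle
      calc s * hypP a s * hypF a (1 - s) ≤ s * hypF a s * (√s)⁻¹ := by
            have := hypF_pos h0 h1 (Ioo_subset_Ico_self (one_sub_mem_Ioo hs))
            gcongr
            linarith
        _ = √s * hypF a s := by
            rw [← div_eq_mul_inv, div_eq_iff hsq.ne']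
            nth_rewrite 1 [← Real.mul_self_sqrt hs0.le]
            ring
  have hlim := hfirst.add hsecond
  rw [one_mul, one_mul, zero_add] at hlim
  have hlim' : Tendsto W (𝓝[>] 0) (𝓝 (W t)) :=
    tendsto_const_nhds.congr' (by filter_upwards [hmem] with s hs using (hconst s hs).symm)
  exact tendsto_nhds_unique hlim' hlim

/-- The ratio `F(1 - t) / F(t)`, which is `μₐ(√t)` up to a constant factor. -/
noncomputable def hypRatio (a t : ℝ) : ℝ := hypF a (1 - t) / hypF a t

theorem hypRatio_pos {a : ℝ} (h0 : 0 < a) (h1 : a < 1) {t : ℝ} (ht : t ∈ Ioo (0 : ℝ) 1) :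
    0 < hypRatio a t :=
  div_pos (hypF_pos h0 h1 (Ioo_subset_Ico_self (one_sub_mem_Ioo ht)))
    (hypF_pos h0 h1 (Ioo_subset_Ico_self ht))

theorem hasDerivAt_hypRatio {a : ℝ} (h0 : 0 < a) (h1 : a < 1) {t : ℝ}
    (ht : t ∈ Ioo (0 : ℝ) 1) :
    HasDerivAt (hypRatio a)
      (-(Real.sin (Real.pi * a) / Real.pi) / (t * (1 - t) * hypF a t ^ 2)) t := by
  have hF := hypF_pos h0 h1 (Ioo_subset_Ico_self ht)
  have h := (hasDerivAt_hypF_one_sub h0 h1 ht).div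
    (hasDerivAt_hypF h0 h1 (abs_lt_one_of_mem_Ico (Ioo_subset_Ico_self ht))) hF.ne'
  refine h.congr_deriv ?_
  rw [← wronskian_eq h0 h1 ht]
  have e1 : t ≠ 0 := ht.1.ne'
  have e2 : 1 - t ≠ 0 := (one_sub_mem_Ioo ht).1.ne'
  field_simp
  ring

theorem strictAntiOn_hypRatio {a : ℝ} (h0 : 0 < a) (h1 : a < 1) :
    StrictAntiOn (hypRatio a) (Ioo 0 1) := by
  intro s hs t ht hst
  have hs' := Ioo_subset_Ico_self hs
  have ht' := Ioo_subset_Ico_self ht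
  have hs1 := Ioo_subset_Ico_self (one_sub_mem_Ioo hs)
  have ht1 := Ioo_subset_Ico_self (one_sub_mem_Ioo ht)
  exact div_lt_div₀ (strictMonoOn_hypF h0 h1 ht1 hs1 (by linarith))
    (strictMonoOn_hypF h0 h1 hs' ht' hst).le (hypF_pos h0 h1 hs1).le (hypF_pos h0 h1 hs')

theorem exists_lt_hypRatio {a : ℝ} (h0 : 0 < a) (h1 : a < 1) (y : ℝ) :
    ∃ t ∈ Ioo (0 : ℝ) 1, y < hypRatio a t := by
  have hnum : Tendsto (fun t => hypF a (1 - t)) (𝓝[>] 0) atTop :=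
    (tendsto_hypF_atTop h0 h1).comp tendsto_one_sub_nhdsGT_zero
  have hden : Tendsto (fun t => (hypF a t)⁻¹) (𝓝[>] 0) (𝓝 1) := by
    have := (hasDerivAt_hypF h0 h1 (x := 0) (by simp)).continuousAt.tendsto
    rw [hypF_zero] at this
    simpa using (this.mono_left nhdsWithin_le_nhds).inv₀ one_ne_zero
  have h := hnum.atTop_mul_pos one_pos hden
  obtain ⟨t, ht, hty⟩ :=
    ((Ioo_mem_nhdsGT (one_pos (α := ℝ)) : Ioo (0 : ℝ) 1 ∈ 𝓝[>] (0 : ℝ)) |>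
      Filter.Eventually.and <| h.eventually_gt_atTop y).exists
  exact ⟨t, ht, by rwa [hypRatio, div_eq_mul_inv]⟩

theorem hypRatio_one_sub (a t : ℝ) : hypRatio a (1 - t) = (hypRatio a t)⁻¹ := by
  rw [hypRatio, hypRatio, sub_sub_cancel, inv_div]

theorem surjOn_hypRatio {a : ℝ} (h0 : 0 < a) (h1 : a < 1) :
    SurjOn (hypRatio a) (Ioo 0 1) (Ioi 0) := by
  intro y hy
  obtain ⟨t, ht, hty⟩ := exists_lt_hypRatio h0 h1 y
  obtain ⟨s, hs, hsy⟩ := exists_lt_hypRatio h0 h1 y⁻¹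
  have hs' : hypRatio a (1 - s) < y := by
    rw [hypRatio_one_sub]
    exact inv_lt_of_inv_lt₀ hy hsy
  exact isPreconnected_Ioo.intermediate_value (one_sub_mem_Ioo hs) ht
    (fun u hu => (hasDerivAt_hypRatio h0 h1 hu).continuousAt.continuousWithinAt)
    ⟨hs'.le, hty.le⟩

theorem ellK_eq (a r : ℝ) : ellK a r = Real.pi / 2 * hypF a (r ^ 2) := by
  rw [ellK, ordinaryHypergeometric_eq_hypF]

theorem muFn_eq (a : ℝ) {r : ℝ} (hr : r ∈ Ioo (0 : ℝ) 1) :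
    muFn a r = Real.pi / (2 * Real.sin (Real.pi * a)) * hypRatio a (r ^ 2) := by
  have : 0 ≤ 1 - r ^ 2 := by nlinarith [hr.1, hr.2]
  rw [muFn, ellK_eq, ellK_eq, Real.sq_sqrt this, hypRatio,
    mul_div_mul_left _ _ (by positivity : Real.pi / 2 ≠ 0)]

theorem sin_pi_mul_pos {a : ℝ} (h0 : 0 < a) (h1 : a < 1) : 0 < Real.sin (Real.pi * a) :=
  Real.sin_pos_of_pos_of_lt_pi (by positivity) (by nlinarith [Real.pi_pos])

theorem sq_mem_Ioo {r : ℝ} (hr : r ∈ Ioo (0 : ℝ) 1) : r ^ 2 ∈ Ioo (0 : ℝ) 1 :=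
  ⟨pow_pos hr.1 2, pow_lt_one₀ hr.1.le hr.2 two_ne_zero⟩

theorem sqrt_mem_Ioo {t : ℝ} (ht : t ∈ Ioo (0 : ℝ) 1) : √t ∈ Ioo (0 : ℝ) 1 :=
  ⟨Real.sqrt_pos.2 ht.1, by simpa using Real.sqrt_lt_sqrt ht.1.le ht.2⟩

theorem surjOn_muFn {a : ℝ} (h0 : 0 < a) (h1 : a < 1) :
    SurjOn (muFn a) (Ioo 0 1) (Ioi 0) := by
  intro y hy
  have hC : 0 < Real.pi / (2 * Real.sin (Real.pi * a)) :=
    div_pos Real.pi_pos (mul_pos two_pos (sin_pi_mul_pos h0 h1))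
  obtain ⟨t, ht, hty⟩ := surjOn_hypRatio h0 h1 (mem_Ioi.2 (div_pos hy hC))
  refine ⟨√t, sqrt_mem_Ioo ht, ?_⟩
  rw [muFn_eq a (sqrt_mem_Ioo ht), Real.sq_sqrt ht.1.le, hty, mul_div_cancel₀ _ hC.ne']

theorem muInv_mem {a : ℝ} (h0 : 0 < a) (h1 : a < 1) {y : ℝ} (hy : 0 < y) :
    muInv a y ∈ Ioo (0 : ℝ) 1 :=
  Function.invFunOn_mem (surjOn_muFn h0 h1 hy)

theorem muFn_muInv {a : ℝ} (h0 : 0 < a) (h1 : a < 1) {y : ℝ} (hy : 0 < y) :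
    muFn a (muInv a y) = y :=
  Function.invFunOn_eq (surjOn_muFn h0 h1 hy)

theorem muFn_pos {a : ℝ} (h0 : 0 < a) (h1 : a < 1) {r : ℝ} (hr : r ∈ Ioo (0 : ℝ) 1) :
    0 < muFn a r := by
  rw [muFn_eq a hr]
  exact mul_pos (div_pos Real.pi_pos (mul_pos two_pos (sin_pi_mul_pos h0 h1)))
    (hypRatio_pos h0 h1 (sq_mem_Ioo hr))

theorem phiK_mem {a : ℝ} (h0 : 0 < a) (h1 : a < 1) {r : ℝ} (hr : r ∈ Ioo (0 : ℝ) 1) {K : ℝ}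
    (hK : 0 < K) : phiK a K r ∈ Ioo (0 : ℝ) 1 :=
  muInv_mem h0 h1 (div_pos (muFn_pos h0 h1 hr) hK)

theorem hypRatio_phiK_sq {a : ℝ} (h0 : 0 < a) (h1 : a < 1) {r : ℝ} (hr : r ∈ Ioo (0 : ℝ) 1)
    {K : ℝ} (hK : 0 < K) : hypRatio a (phiK a K r ^ 2) = hypRatio a (r ^ 2) / K := by
  have h := muFn_muInv h0 h1 (div_pos (muFn_pos h0 h1 hr) hK)
  have hC : 0 < Real.pi / (2 * Real.sin (Real.pi * a)) :=
    div_pos Real.pi_pos (mul_pos two_pos (sin_pi_mul_pos h0 h1))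
  change muFn a (phiK a K r) = _ at h
  rw [muFn_eq a (phiK_mem h0 h1 hr hK), muFn_eq a hr, mul_div_assoc] at h
  exact mul_left_cancel₀ hC.ne' h

end Modulus

section Slope

open Set Filter Topology

theorem exists_gt_mem_slope_near {h h' : ℝ → ℝ} (hd : HasDerivAt h (h' 1) 1) {U : Set ℝ}
    (hU : U ∈ 𝓝 (h' 1)) : ∃ K ∈ Ioi (1 : ℝ), (h K - h 1) / (K - 1) ∈ U := by
  have ht := (hasDerivAt_iff_tendsto_slope.1 hd).mono_left
    (nhdsWithin_mono (1 : ℝ) (fun K (hK : 1 < K) => hK.ne') : 𝓝[>] (1 : ℝ) ≤ 𝓝[≠] 1)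
  obtain ⟨K, hK, hKU⟩ := ((eventually_mem_nhdsWithin).and (ht.eventually hU)).exists
  exact ⟨K, hK, slope_def_field h 1 K ▸ hKU⟩

theorem exists_slope_eq {h h' : ℝ → ℝ} (hd : ∀ K > 0, HasDerivAt h (h' K) K) {K₀ K : ℝ}
    (h0 : 0 < K₀) (hK : K₀ < K) :
    ∃ ξ ∈ Ioo K₀ K, (h K - h K₀) / (K - K₀) = h' ξ := by
  obtain ⟨ξ, hξ, e⟩ := exists_hasDerivAt_eq_slope h h' hK
    (fun y hy => (hd y (h0.trans_le hy.1)).continuousAt.continuousWithinAt)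
    (fun y hy => hd y (h0.trans hy.1))
  exact ⟨ξ, hξ, e.symm⟩

theorem continuousOn_slope_one {h h' : ℝ → ℝ} (hd : ∀ K > 0, HasDerivAt h (h' K) K) :
    ContinuousOn (fun K => (h K - h 1) / (K - 1)) (Ioi 1) := fun K hK =>
  have hK : 1 < K := hK
  ((((hd K (by linarith)).continuousAt.sub continuousAt_const).div
    (continuousAt_id.sub continuousAt_const) (sub_ne_zero.2 hK.ne'))).continuousWithinAt

theorem strictMonoOn_slope_one {h h' : ℝ → ℝ} (hd : ∀ K > 0, HasDerivAt h (h' K) K)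
    (hm : StrictMonoOn h' (Ioi 0)) :
    StrictMonoOn (fun K => (h K - h 1) / (K - 1)) (Ioi 1) := by
  have hc : StrictConvexOn ℝ (Ioi 0) h := by
    refine StrictMonoOn.strictConvexOn_of_deriv (convex_Ioi 0)
      (fun K hK => (hd K hK).continuousAt.continuousWithinAt) ?_
    rw [interior_Ioi]
    exact hm.congr fun K hK => (hd K hK).deriv.symm
  intro K hK L hL hKL
  have hK : 1 < K := hK
  have hL : 1 < L := hL
  exact hc.secant_strict_mono (mem_Ioi.2 one_pos) (mem_Ioi.2 (by linarith))
    (mem_Ioi.2 (by linarith)) hK.ne' hL.ne' hKL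

theorem strictAntiOn_slope_one {h h' : ℝ → ℝ} (hd : ∀ K > 0, HasDerivAt h (h' K) K)
    (hm : StrictAntiOn h' (Ioi 0)) :
    StrictAntiOn (fun K => (h K - h 1) / (K - 1)) (Ioi 1) := by
  have H := strictMonoOn_slope_one (h := fun K => -h K) (h' := fun K => -h' K)
    (fun K hK => (hd K hK).neg) hm.neg
  intro K hK L hL hKL
  have := H hK hL hKL
  beta_reduce at this ⊢
  rw [show (-h K - -h 1) / (K - 1) = -((h K - h 1) / (K - 1)) by ring,
    show (-h L - -h 1) / (L - 1) = -((h L - h 1) / (L - 1)) by ring] at this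
  linarith

theorem image_slope_one_eq_Ioi {h h' : ℝ → ℝ} (hd : ∀ K > 0, HasDerivAt h (h' K) K)
    (hm : StrictMonoOn h' (Ioi 0))
    (hunb : ∀ y, ∃ K ∈ Ioi (1 : ℝ), y < (h K - h 1) / (K - 1)) :
    (fun K => (h K - h 1) / (K - 1)) '' Ioi 1 = Ioi (h' 1) := by
  refine Subset.antisymm ?_ fun y hy => ?_
  · rintro _ ⟨K, hK, rfl⟩
    obtain ⟨ξ, hξ, e⟩ := exists_slope_eq hd one_pos hK
    simp only [e]
    exact hm (mem_Ioi.2 one_pos) (mem_Ioi.2 (one_pos.trans hξ.1)) hξ.1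
  · obtain ⟨K, hK, hKy⟩ := exists_gt_mem_slope_near (hd 1 one_pos) (Iio_mem_nhds hy)
    obtain ⟨L, hL, hLy⟩ := hunb y
    exact isPreconnected_Ioi.intermediate_value hK hL (continuousOn_slope_one hd)
      ⟨le_of_lt hKy, hLy.le⟩

theorem image_slope_one_eq_Ioo {h h' : ℝ → ℝ} {l : ℝ} (hd : ∀ K > 0, HasDerivAt h (h' K) K)
    (hm : StrictAntiOn h' (Ioi 0)) (hl : Tendsto h' atTop (𝓝 l)) :
    (fun K => (h K - h 1) / (K - 1)) '' Ioi 1 = Ioo l (h' 1) := by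
  have hlt : ∀ K > 0, l < h' K := fun K hK => by
    have h1 : h' (K + 1) < h' K := hm hK (mem_Ioi.2 (by linarith)) (by linarith)
    refine lt_of_le_of_lt (le_of_tendsto hl ?_) h1
    filter_upwards [eventually_ge_atTop (K + 1)] with L hL
    exact hm.antitoneOn (mem_Ioi.2 (by linarith)) (mem_Ioi.2 (by linarith)) hL
  refine Subset.antisymm ?_ fun y hy => ?_
  · rintro _ ⟨K, hK, rfl⟩
    obtain ⟨ξ, hξ, e⟩ := exists_slope_eq hd one_pos hK
    simp only [e]
    have hξ0 : 0 < ξ := one_pos.trans hξ.1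
    exact ⟨hlt ξ hξ0, hm (mem_Ioi.2 one_pos) (mem_Ioi.2 hξ0) hξ.1⟩
  · obtain ⟨K, hK, hKy⟩ := exists_gt_mem_slope_near (hd 1 one_pos) (Ioi_mem_nhds hy.2)
    obtain ⟨K₀, hK₀, hK₀y⟩ :=
      ((eventually_gt_atTop (1 : ℝ)).and (hl.eventually_lt_const hy.1)).exists
    set z := h' K₀
    set L := max (K₀ + 1) ((h K₀ - h 1 - z * K₀ + y) / (y - z) + 1)
    have hL1 : K₀ + 1 ≤ L := le_max_left _ _
    have hL2 : (h K₀ - h 1 - z * K₀ + y) / (y - z) < L :=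
      lt_of_lt_of_le (by linarith) (le_max_right _ _)
    have hyz : 0 < y - z := by linarith
    rw [div_lt_iff₀ hyz] at hL2
    have hLy : (h L - h 1) / (L - 1) < y := by
      obtain ⟨ξ, hξ, e⟩ := exists_slope_eq hd (by linarith : 0 < K₀) (by linarith : K₀ < L)
      have hξz : h' ξ < z :=
        hm (mem_Ioi.2 (by linarith)) (mem_Ioi.2 (by linarith [hξ.1])) hξ.1
      rw [← e, div_lt_iff₀ (by linarith)] at hξz
      rw [div_lt_iff₀ (by linarith)]
      linarith
    exact isPreconnected_Ioi.intermediate_value (mem_Ioi.2 (by linarith : 1 < L)) hK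
      (continuousOn_slope_one hd) ⟨hLy.le, le_of_lt hKy⟩

end Slope

section Eta

open Set Filter Topology

theorem div_one_add_mem_Ioo {x : ℝ} (hx : 0 < x) : x / (1 + x) ∈ Ioo (0 : ℝ) 1 :=
  ⟨by positivity, by rw [div_lt_one (by positivity)]; linarith⟩

/-- The square of `φ_K^a(√(x / (1 + x)))`. -/
noncomputable def phiSq (a x K : ℝ) : ℝ := phiK a K (√(x / (1 + x))) ^ 2

theorem phiSq_mem {a : ℝ} (h0 : 0 < a) (h1 : a < 1) {x : ℝ} (hx : 0 < x) {K : ℝ} (hK : 0 < K) :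
    phiSq a x K ∈ Ioo (0 : ℝ) 1 :=
  sq_mem_Ioo (phiK_mem h0 h1 (sqrt_mem_Ioo (div_one_add_mem_Ioo hx)) hK)

theorem hypRatio_phiSq {a : ℝ} (h0 : 0 < a) (h1 : a < 1) {x : ℝ} (hx : 0 < x) {K : ℝ}
    (hK : 0 < K) : hypRatio a (phiSq a x K) = hypRatio a (x / (1 + x)) / K := by
  have ht := div_one_add_mem_Ioo hx
  rw [phiSq, hypRatio_phiK_sq h0 h1 (sqrt_mem_Ioo ht) hK, Real.sq_sqrt ht.1.le]

theorem etaK_eq {a : ℝ} (h0 : 0 < a) (h1 : a < 1) {x : ℝ} (hx : 0 < x) {K : ℝ} (hK : 0 < K) :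
    etaK a K x = phiSq a x K / (1 - phiSq a x K) := by
  have h := phiSq_mem h0 h1 hx hK
  rw [phiSq] at h
  rw [etaK, div_pow, Real.sq_sqrt (by linarith [h.2]), phiSq]

theorem phiSq_eq_of_hypRatio {a : ℝ} (h0 : 0 < a) (h1 : a < 1) {x : ℝ} (hx : 0 < x) {t : ℝ}
    (ht : t ∈ Ioo (0 : ℝ) 1) :
    phiSq a x (hypRatio a (x / (1 + x)) / hypRatio a t) = t := by
  have hm := hypRatio_pos h0 h1 ht
  have hm0 := hypRatio_pos h0 h1 (div_one_add_mem_Ioo hx)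
  have hK : 0 < hypRatio a (x / (1 + x)) / hypRatio a t := div_pos hm0 hm
  refine (strictAntiOn_hypRatio h0 h1).injOn (phiSq_mem h0 h1 hx hK) ht ?_
  rw [hypRatio_phiSq h0 h1 hx hK, div_div_cancel₀ hm0.ne']

theorem phiSq_one {a : ℝ} (h0 : 0 < a) (h1 : a < 1) {x : ℝ} (hx : 0 < x) :
    phiSq a x 1 = x / (1 + x) := by
  have h := phiSq_eq_of_hypRatio h0 h1 hx (div_one_add_mem_Ioo hx)
  rwa [div_self (hypRatio_pos h0 h1 (div_one_add_mem_Ioo hx)).ne'] at h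

theorem etaK_one {a : ℝ} (h0 : 0 < a) (h1 : a < 1) {x : ℝ} (hx : 0 < x) :
    etaK a 1 x = x := by
  rw [etaK_eq h0 h1 hx one_pos, phiSq_one h0 h1 hx]
  field_simp
  ring

theorem strictMonoOn_phiSq {a : ℝ} (h0 : 0 < a) (h1 : a < 1) {x : ℝ} (hx : 0 < x) :
    StrictMonoOn (phiSq a x) (Ioi 0) := by
  intro K hK L hL hKL
  refine ((strictAntiOn_hypRatio h0 h1).lt_iff_gt (phiSq_mem h0 h1 hx hL)
    (phiSq_mem h0 h1 hx hK)).1 ?_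
  rw [hypRatio_phiSq h0 h1 hx hK, hypRatio_phiSq h0 h1 hx hL]
  exact div_lt_div_of_pos_left (hypRatio_pos h0 h1 (div_one_add_mem_Ioo hx)) hK hKL

theorem image_phiSq {a : ℝ} (h0 : 0 < a) (h1 : a < 1) {x : ℝ} (hx : 0 < x) :
    phiSq a x '' Ioi 0 = Ioo 0 1 := by
  refine Subset.antisymm (image_subset_iff.2 fun K hK => phiSq_mem h0 h1 hx hK) fun t ht => ?_
  exact ⟨_, mem_Ioi.2 (div_pos (hypRatio_pos h0 h1 (div_one_add_mem_Ioo hx))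
    (hypRatio_pos h0 h1 ht)), phiSq_eq_of_hypRatio h0 h1 hx ht⟩

theorem continuousAt_phiSq {a : ℝ} (h0 : 0 < a) (h1 : a < 1) {x : ℝ} (hx : 0 < x) {K : ℝ}
    (hK : 0 < K) : ContinuousAt (phiSq a x) K := by
  refine (strictMonoOn_phiSq h0 h1 hx).continuousAt_of_image_mem_nhds (Ioi_mem_nhds hK) ?_
  rw [image_phiSq h0 h1 hx]
  exact isOpen_Ioo.mem_nhds (phiSq_mem h0 h1 hx hK)

theorem tendsto_phiSq {a : ℝ} (h0 : 0 < a) (h1 : a < 1) {x : ℝ} (hx : 0 < x) :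
    Tendsto (phiSq a x) atTop (𝓝 1) := by
  refine tendsto_order.2 ⟨fun b hb => ?_, fun b hb => ?_⟩
  · obtain ⟨t, ht0, ht1⟩ := exists_between (max_lt hb one_pos)
    obtain ⟨K₀, hK₀, e⟩ := (image_phiSq h0 h1 hx).symm.subset
      (⟨(le_max_right b 0).trans_lt ht0, ht1⟩ : t ∈ Ioo (0 : ℝ) 1)
    filter_upwards [eventually_ge_atTop K₀] with K hK
    have := (strictMonoOn_phiSq h0 h1 hx).monotoneOn hK₀
      (mem_Ioi.2 (lt_of_lt_of_le hK₀ hK)) hK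
    rw [e] at this
    exact ((le_max_left b 0).trans_lt ht0).trans_le this
  · filter_upwards [eventually_gt_atTop 0] with K hK
    exact (phiSq_mem h0 h1 hx hK).2.trans hb

theorem hasDerivAt_phiSq {a : ℝ} (h0 : 0 < a) (h1 : a < 1) {x : ℝ} (hx : 0 < x) {K : ℝ}
    (hK : 0 < K) :
    HasDerivAt (phiSq a x) (phiSq a x K * (1 - phiSq a x K) *
      (hypF a (1 - phiSq a x K) ^ 2 /
        (Real.sin (Real.pi * a) / Real.pi * hypRatio a (x / (1 + x))))) K := by
  have hT := phiSq_mem h0 h1 hx hK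
  have hm0 := hypRatio_pos h0 h1 (div_one_add_mem_Ioo hx)
  have hS := sin_pi_mul_pos h0 h1
  have hF := hypF_pos h0 h1 (Ioo_subset_Ico_self hT)
  have hT1 : 0 < 1 - phiSq a x K := by linarith [hT.2]
  have hT0 := hT.1
  have hh : HasDerivAt (fun L : ℝ => hypRatio a (x / (1 + x)) / L)
      (hypRatio a (x / (1 + x)) * (-(K ^ 2)⁻¹)) K := by
    simpa only [div_eq_mul_inv] using (hasDerivAt_inv hK.ne').const_mul _
  have hne : -(Real.sin (Real.pi * a) / Real.pi) /
      (phiSq a x K * (1 - phiSq a x K) * hypF a (phiSq a x K) ^ 2) ≠ 0 := by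
    have := Real.pi_pos
    exact div_ne_zero (neg_ne_zero.2 (by positivity)) (by positivity)
  have h := HasDerivAt.of_comp_left (continuousAt_phiSq h0 h1 hx hK)
    (hasDerivAt_hypRatio h0 h1 hT) hh hne (by
      filter_upwards [Ioi_mem_nhds hK] with L hL
      exact hypRatio_phiSq h0 h1 hx hL)
  refine h.congr_deriv ?_
  have hr := hypRatio_phiSq h0 h1 hx hK
  rw [hypRatio, div_eq_div_iff hF.ne' hK.ne'] at hr
  have hr' : hypF a (1 - phiSq a x K) =
    hypRatio a (x / (1 + x)) * hypF a (phiSq a x K) / K := by rw [← hr]; field_simp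
  rw [hr']
  have := Real.pi_pos
  field_simp

/-- The derivative of `K ↦ log η_K^a(x)`. -/
noncomputable def logEtaDeriv (a x K : ℝ) : ℝ :=
  hypF a (1 - phiSq a x K) ^ 2 /
    (Real.sin (Real.pi * a) / Real.pi * hypRatio a (x / (1 + x)))

theorem etaK_pos {a : ℝ} (h0 : 0 < a) (h1 : a < 1) {x : ℝ} (hx : 0 < x) {K : ℝ} (hK : 0 < K) :
    0 < etaK a K x := by
  have hT := phiSq_mem h0 h1 hx hK
  rw [etaK_eq h0 h1 hx hK]
  exact div_pos hT.1 (by linarith [hT.2])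

theorem hasDerivAt_etaK {a : ℝ} (h0 : 0 < a) (h1 : a < 1) {x : ℝ} (hx : 0 < x) {K : ℝ}
    (hK : 0 < K) :
    HasDerivAt (fun K => etaK a K x) (etaK a K x * logEtaDeriv a x K) K := by
  have hT := phiSq_mem h0 h1 hx hK
  have hT1 : 1 - phiSq a x K ≠ 0 := by linarith [hT.2]
  have hd := hasDerivAt_phiSq h0 h1 hx hK
  have h := hd.div (hd.const_sub 1) hT1
  have h' := h.congr_of_eventuallyEq (f₁ := fun K => etaK a K x) (by
    filter_upwards [Ioi_mem_nhds hK] with L hL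
    exact etaK_eq h0 h1 hx hL)
  refine h'.congr_deriv ?_
  rw [etaK_eq h0 h1 hx hK, ← logEtaDeriv]
  field_simp
  ring

theorem hasDerivAt_log_etaK {a : ℝ} (h0 : 0 < a) (h1 : a < 1) {x : ℝ} (hx : 0 < x) {K : ℝ}
    (hK : 0 < K) :
    HasDerivAt (fun K => Real.log (etaK a K x)) (logEtaDeriv a x K) K := by
  have hη := (etaK_pos h0 h1 hx hK).ne'
  exact ((hasDerivAt_etaK h0 h1 hx hK).log hη).congr_deriv (mul_div_cancel_left₀ _ hη)

theorem logEtaDeriv_denom_pos {a : ℝ} (h0 : 0 < a) (h1 : a < 1) {x : ℝ} (hx : 0 < x) :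
    0 < Real.sin (Real.pi * a) / Real.pi * hypRatio a (x / (1 + x)) :=
  mul_pos (div_pos (sin_pi_mul_pos h0 h1) Real.pi_pos)
    (hypRatio_pos h0 h1 (div_one_add_mem_Ioo hx))

theorem strictAntiOn_logEtaDeriv {a : ℝ} (h0 : 0 < a) (h1 : a < 1) {x : ℝ} (hx : 0 < x) :
    StrictAntiOn (logEtaDeriv a x) (Ioi 0) := by
  intro K hK L hL hKL
  have hT := strictMonoOn_phiSq h0 h1 hx hK hL hKL
  have hKm := Ioo_subset_Ico_self (one_sub_mem_Ioo (phiSq_mem h0 h1 hx hK))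
  have hLm := Ioo_subset_Ico_self (one_sub_mem_Ioo (phiSq_mem h0 h1 hx hL))
  refine div_lt_div_of_pos_right ?_ (logEtaDeriv_denom_pos h0 h1 hx)
  exact pow_lt_pow_left₀ (strictMonoOn_hypF h0 h1 hLm hKm (by linarith))
    (hypF_pos h0 h1 hLm).le two_ne_zero

theorem strictMonoOn_etaK_mul_logEtaDeriv {a : ℝ} (h0 : 0 < a) (h1 : a < 1) {x : ℝ}
    (hx : 0 < x) : StrictMonoOn (fun K => etaK a K x * logEtaDeriv a x K) (Ioi 0) := by
  intro K hK L hL hKL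
  have hT := strictMonoOn_phiSq h0 h1 hx hK hL hKL
  have hKm := one_sub_mem_Ioo (phiSq_mem h0 h1 hx hK)
  have hLm := one_sub_mem_Ioo (phiSq_mem h0 h1 hx hL)
  have hanti := antitoneOn_one_sub_mul_hypF_sq h0 h1 (Ioo_subset_Ico_self hLm)
    (Ioo_subset_Ico_self hKm) (by linarith)
  simp only [sub_sub_cancel] at hanti
  have hpos := mul_pos (phiSq_mem h0 h1 hx hK).1
    (pow_pos (hypF_pos h0 h1 (Ioo_subset_Ico_self hKm)) 2)
  simp only [logEtaDeriv, etaK_eq h0 h1 hx hK, etaK_eq h0 h1 hx hL, ← mul_div_assoc]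
  refine div_lt_div_of_pos_right ?_ (logEtaDeriv_denom_pos h0 h1 hx)
  rw [div_mul_eq_mul_div, div_mul_eq_mul_div]
  exact div_lt_div₀' hanti (by linarith) (hpos.trans_le hanti) hLm.1

theorem tendsto_logEtaDeriv {a : ℝ} (h0 : 0 < a) (h1 : a < 1) {x : ℝ} (hx : 0 < x) :
    Tendsto (logEtaDeriv a x) atTop
      (𝓝 (1 / (Real.sin (Real.pi * a) / Real.pi * hypRatio a (x / (1 + x))))) := by
  have hF : Tendsto (hypF a) (𝓝 0) (𝓝 1) := by
    have := (hasDerivAt_hypF h0 h1 (x := 0) (by simp)).continuousAt.tendsto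
    rwa [hypF_zero] at this
  have hT : Tendsto (fun K => 1 - phiSq a x K) atTop (𝓝 0) := by
    simpa using (tendsto_phiSq h0 h1 hx).const_sub 1
  have h := ((hF.comp hT).pow 2).div_const
    (Real.sin (Real.pi * a) / Real.pi * hypRatio a (x / (1 + x)))
  rwa [one_pow] at h

theorem exists_lt_slope_etaK {a : ℝ} (h0 : 0 < a) (h1 : a < 1) {x : ℝ} (hx : 0 < x) (y : ℝ) :
    ∃ K ∈ Ioi (1 : ℝ), y < (etaK a K x - etaK a 1 x) / (K - 1) := by
  set c := 1 / (Real.sin (Real.pi * a) / Real.pi * hypRatio a (x / (1 + x)))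
  have hcpos : 0 < c := one_div_pos.2 (logEtaDeriv_denom_pos h0 h1 hx)
  have himg := image_slope_one_eq_Ioo (fun K hK => hasDerivAt_log_etaK h0 h1 hx hK)
    (strictAntiOn_logEtaDeriv h0 h1 hx) (tendsto_logEtaDeriv h0 h1 hx)
  obtain ⟨d, hd0, hdy⟩ : ∃ d : ℝ, 0 < d ∧ y < x * (c ^ 2 * d / 2) := by
    refine ⟨2 * (|y| + 1) / (x * c ^ 2), by positivity, ?_⟩
    have e : x * (c ^ 2 * (2 * (|y| + 1) / (x * c ^ 2)) / 2) = |y| + 1 := by field_simp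
    rw [e]
    linarith [le_abs_self y]
  refine ⟨1 + d, mem_Ioi.2 (by linarith), ?_⟩
  have hlog := (himg.subset ⟨1 + d, mem_Ioi.2 (by linarith), rfl⟩).1
  have hη := etaK_pos h0 h1 hx (by linarith : 0 < 1 + d)
  simp only [etaK_one h0 h1 hx, add_sub_cancel_left] at hlog ⊢
  rw [lt_div_iff₀ hd0] at hlog ⊢
  have hexp : x * Real.exp (c * d) < etaK a (1 + d) x := by
    rw [← Real.log_lt_log_iff (by positivity) hη, Real.log_mul hx.ne' (Real.exp_ne_zero _),
      Real.log_exp]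
    linarith
  have hq := Real.quadratic_le_exp_of_nonneg (by positivity : 0 ≤ c * d)
  have h3 : x * (1 + c * d + (c * d) ^ 2 / 2) ≤ x * Real.exp (c * d) :=
    mul_le_mul_of_nonneg_left hq hx.le
  have h4 : y * d < x * (c ^ 2 * d / 2) * d := mul_lt_mul_of_pos_right hdy hd0
  have h5 : 0 < x * (c * d) := by positivity
  nlinarith

end Eta

theorem stmt13 (a : ℝ) (ha : a ∈ Set.Ioc (0 : ℝ) (1 / 2)) (x : ℝ) (hx : 0 < x)
    (r r' : ℝ) (hr : r = Real.sqrt (x / (x + 1))) (hr' : r' = Real.sqrt (1 - r ^ 2)) :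
    (StrictAntiOn (fun K : ℝ => (Real.log (etaK a K x) - Real.log x) / (K - 1)) (Set.Ioi 1) ∧
      (fun K : ℝ => (Real.log (etaK a K x) - Real.log x) / (K - 1)) '' Set.Ioi 1 =
        Set.Ioo (Real.pi * ellK a r / (Real.sin (Real.pi * a) * ellK a r'))
          (4 * ellK a r * ellK a r' / (Real.pi * Real.sin (Real.pi * a)))) ∧
    (StrictMonoOn (fun K : ℝ => (etaK a K x - x) / (K - 1)) (Set.Ioi 1) ∧
      (fun K : ℝ => (etaK a K x - x) / (K - 1)) '' Set.Ioi 1 =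
        Set.Ioi (4 * r ^ 2 * ellK a r * ellK a r' /
          (Real.pi * Real.sin (Real.pi * a) * r' ^ 2))) := by
  have h0 : 0 < a := ha.1
  have h1 : a < 1 := by linarith [ha.2]
  have ht := div_one_add_mem_Ioo hx
  have ht' := one_sub_mem_Ioo ht
  have hr2 : r ^ 2 = x / (1 + x) := by rw [hr, add_comm x 1, Real.sq_sqrt ht.1.le]
  have hr'2 : r' ^ 2 = 1 - x / (1 + x) := by rw [hr', hr2, Real.sq_sqrt ht'.1.le]
  have hF := hypF_pos h0 h1 (Set.Ioo_subset_Ico_self ht)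
  have hF' := hypF_pos h0 h1 (Set.Ioo_subset_Ico_self ht')
  have hsin := sin_pi_mul_pos h0 h1
  have hpi := Real.pi_pos
  have hK : ellK a r = Real.pi / 2 * hypF a (x / (1 + x)) := by rw [ellK_eq, hr2]
  have hK' : ellK a r' = Real.pi / 2 * hypF a (1 - x / (1 + x)) := by rw [ellK_eq, hr'2]
  have hlower : 1 / (Real.sin (Real.pi * a) / Real.pi * hypRatio a (x / (1 + x))) =
      Real.pi * ellK a r / (Real.sin (Real.pi * a) * ellK a r') := by
    rw [hK, hK', hypRatio]
    field_simp
  have hupper : logEtaDeriv a x 1 =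
      4 * ellK a r * ellK a r' / (Real.pi * Real.sin (Real.pi * a)) := by
    rw [hK, hK', logEtaDeriv, phiSq_one h0 h1 hx, hypRatio]
    field_simp
    ring
  have hupper' : etaK a 1 x * logEtaDeriv a x 1 = 4 * r ^ 2 * ellK a r * ellK a r' /
      (Real.pi * Real.sin (Real.pi * a) * r' ^ 2) := by
    have hxr : x = r ^ 2 / r' ^ 2 := by
      rw [hr2, hr'2]
      field_simp
      ring
    rw [hupper, etaK_one h0 h1 hx]
    nth_rewrite 1 [hxr]
    ring
  have hdlog := fun (K : ℝ) (hK : K > 0) => hasDerivAt_log_etaK h0 h1 hx hK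
  have hdeta := fun (K : ℝ) (hK : K > 0) => hasDerivAt_etaK h0 h1 hx hK
  have hanti := strictAntiOn_slope_one hdlog (strictAntiOn_logEtaDeriv h0 h1 hx)
  have himg := image_slope_one_eq_Ioo hdlog (strictAntiOn_logEtaDeriv h0 h1 hx)
    (tendsto_logEtaDeriv h0 h1 hx)
  have hmono := strictMonoOn_slope_one hdeta (strictMonoOn_etaK_mul_logEtaDeriv h0 h1 hx)
  have himg' := image_slope_one_eq_Ioi hdeta (strictMonoOn_etaK_mul_logEtaDeriv h0 h1 hx)
    (exists_lt_slope_etaK h0 h1 hx)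
  rw [hlower, hupper] at himg
  rw [hupper'] at himg'
  simp only [etaK_one h0 h1 hx] at hanti himg hmono himg'
  exact ⟨⟨hanti, himg⟩, hmono, himg'⟩
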